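/- Let n ≥ 2 and let p ∈ 𝒫ᵉ_{n+1} be of the form p = p^h − 1, where p^h is a homogeneous polynomial of degree m ≥ 2. Let u be a global solution to the thin obstacle problem (with zero obstacle) in ℝ^{n+1} such that |u(x) − p(x)| → 0 as |x| → ∞. Then the contact set Λ(u) is compact and star-shaped with respect to the origin. -/

import Mathlib

open MeasureTheory Metric Set Filter

noncomputable section

/-- The point `(x', t)` of `ℝ^{n+1}`, where `x' ∈ ℝ^n`. -/
def thinEmbed (n : ℕ) (x' : EuclideanSpace ℝ (Fin n)) (t : ℝ) :
    EuclideanSpace ℝ (Fin (n + 1)) :=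
  (EuclideanSpace.equiv (Fin (n + 1)) ℝ).symm (Fin.snoc (fun i => x' i) t)

/-- Projection of a point of `ℝ^{n+1}` to its first `n` coordinates. -/
def thinProj (n : ℕ) (x : EuclideanSpace ℝ (Fin (n + 1))) : EuclideanSpace ℝ (Fin n) :=
  (EuclideanSpace.equiv (Fin n) ℝ).symm (fun i => x i.castSucc)

/-- The Laplacian of `f : ℝ^d → ℝ`: the sum of pure second partial derivatives. -/
def lapl (d : ℕ) (f : EuclideanSpace ℝ (Fin d) → ℝ) (x : EuclideanSpace ℝ (Fin d)) : ℝ :=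
  ∑ i : Fin d,
    fderiv ℝ (fun y => fderiv ℝ f y (EuclideanSpace.single i 1)) x (EuclideanSpace.single i 1)

/-- `f` is harmonic on a set: twice continuously differentiable with vanishing Laplacian. -/
def IsHarmonicOnSet (d : ℕ) (f : EuclideanSpace ℝ (Fin d) → ℝ)
    (s : Set (EuclideanSpace ℝ (Fin d))) : Prop :=
  ContDiffOn ℝ 2 f s ∧ ∀ x ∈ s, lapl d f x = 0

/-- Super-mean-value property w.r.t. averages over balls
(encodes `Δf ≤ 0` for continuous `f`). -/
def SuperMeanVal (d : ℕ) (f : EuclideanSpace ℝ (Fin d) → ℝ) : Prop :=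
  ∀ (x : EuclideanSpace ℝ (Fin d)) (r : ℝ), 0 < r → (⨍ y in Metric.ball x r, f y) ≤ f x

/-- The contact set `Λ_φ(u) = {(x',0) : u(x',0) = φ(x')}`. -/
def contactSet (n : ℕ) (φ : EuclideanSpace ℝ (Fin n) → ℝ)
    (u : EuclideanSpace ℝ (Fin (n + 1)) → ℝ) : Set (EuclideanSpace ℝ (Fin (n + 1))) :=
  {x | x (Fin.last n) = 0 ∧ u x = φ (thinProj n x)}

/-- Global solution to the thin obstacle problem in `ℝ^{n+1}` with thin obstacle `φ`:
continuous, even in the last variable, above the obstacle on the thin space,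
harmonic outside the contact set, and superharmonic (mean value inequality). -/
def IsGlobalSolution (n : ℕ) (φ : EuclideanSpace ℝ (Fin n) → ℝ)
    (u : EuclideanSpace ℝ (Fin (n + 1)) → ℝ) : Prop :=
  Continuous u ∧
  (∀ x' t, u (thinEmbed n x' t) = u (thinEmbed n x' (-t))) ∧
  (∀ x', φ x' ≤ u (thinEmbed n x' 0)) ∧
  IsHarmonicOnSet (n + 1) u (contactSet n φ u)ᶜ ∧
  SuperMeanVal (n + 1) u

/-- Evaluation of a real polynomial at a point of `ℝ^d`. -/
def pev {d : ℕ} (q : MvPolynomial (Fin d) ℝ) (x : EuclideanSpace ℝ (Fin d)) : ℝ :=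
  MvPolynomial.eval (fun i => x i) q

/-- Polynomial growth (of some order). -/
def HasPolyGrowth (d : ℕ) (u : EuclideanSpace ℝ (Fin d) → ℝ) : Prop :=
  ∃ (m : ℕ) (C : ℝ), ∀ x, |u x| ≤ C * (1 + ‖x‖ ^ m)

/-- Polynomial growth of order exactly `m` (and `m` is the smallest such order). -/
def PolyGrowthOrder (d : ℕ) (u : EuclideanSpace ℝ (Fin d) → ℝ) (m : ℕ) : Prop :=
  (∃ C : ℝ, ∀ x, |u x| ≤ C * (1 + ‖x‖ ^ m)) ∧
  ∀ m' : ℕ, (∃ C : ℝ, ∀ x, |u x| ≤ C * (1 + ‖x‖ ^ m')) → m ≤ m'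

/-- The class `𝒫ᵒ_{n+1}`: polynomials `q` even in the last variable such that
`x_{n+1} q(x)` is harmonic and `closure {q(·,0) < 0}` is compact. -/
def MemPo (n : ℕ) (q : MvPolynomial (Fin (n + 1)) ℝ) : Prop :=
  (∀ x' t, pev q (thinEmbed n x' t) = pev q (thinEmbed n x' (-t))) ∧
  IsHarmonicOnSet (n + 1) (fun x => x (Fin.last n) * pev q x) Set.univ ∧
  IsCompact (closure {x' : EuclideanSpace ℝ (Fin n) | pev q (thinEmbed n x' 0) < 0})

/-- The class `𝒫ᵉ_{n+1}`: harmonic polynomials `p` even in the last variable such that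
`closure {p(·,0) < 0}` is compact. -/
def MemPe (n : ℕ) (p : MvPolynomial (Fin (n + 1)) ℝ) : Prop :=
  (∀ x' t, pev p (thinEmbed n x' t) = pev p (thinEmbed n x' (-t))) ∧
  IsHarmonicOnSet (n + 1) (pev p) Set.univ ∧
  IsCompact (closure {x' : EuclideanSpace ℝ (Fin n) | pev p (thinEmbed n x' 0) < 0})

/-- `f(x) → 0` as `|x| → ∞`. -/
def VanishAtInfty (d : ℕ) (f : EuclideanSpace ℝ (Fin d) → ℝ) : Prop :=
  ∀ ε > 0, ∃ R : ℝ, ∀ x, R ≤ ‖x‖ → |f x| < ε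

/-- The embedding of a subset of `ℝ^n` into the thin space of `ℝ^{n+1}`. -/
def thinSet (n : ℕ) (S : Set (EuclideanSpace ℝ (Fin n))) :
    Set (EuclideanSpace ℝ (Fin (n + 1))) :=
  (fun x' => thinEmbed n x' 0) '' S

/-- The free boundary `Γ(u)`: the boundary in `ℝ^n` of the positivity set, embedded. -/
def freeBoundary (n : ℕ) (u : EuclideanSpace ℝ (Fin (n + 1)) → ℝ) :
    Set (EuclideanSpace ℝ (Fin (n + 1))) :=
  thinSet n (frontier {x' : EuclideanSpace ℝ (Fin n) | 0 < u (thinEmbed n x' 0)})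

/-- Negating the `i`-th coordinate of a point of `ℝ^d`. -/
def negCoordAt (d : ℕ) (i : Fin d) (x : EuclideanSpace ℝ (Fin d)) :
    EuclideanSpace ℝ (Fin d) :=
  (EuclideanSpace.equiv (Fin d) ℝ).symm (Function.update (fun j => x j) i (-(x i)))

/-- The constant `ρ̄(k, n)`, where `κ = k/(n-1)`. -/
def rhoBar (k n : ℕ) : ℝ :=
  ((k : ℝ) / ((n : ℝ) - 1)) ^ (-(1 : ℝ) / (((n : ℝ) - 1) * ((k : ℝ) / ((n : ℝ) - 1) + 1))) *
    (((k : ℝ) / ((n : ℝ) - 1)) ^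
        (-((k : ℝ) / ((n : ℝ) - 1)) / ((k : ℝ) / ((n : ℝ) - 1) + 1)) +
      ((k : ℝ) / ((n : ℝ) - 1)) ^ ((1 : ℝ) / ((k : ℝ) / ((n : ℝ) - 1) + 1))) ^
      (-(1 : ℝ) / (((n : ℝ) - 1) * ((k : ℝ) / ((n : ℝ) - 1))))

/-- The barrier function `g_{A,t}(r) = A r^{1-n} + t - 1 + r^k`. -/
def gfun (n k : ℕ) (A t r : ℝ) : ℝ :=
  A * r ^ ((1 : ℝ) - (n : ℝ)) + t - 1 + r ^ k

open Topology Asymptotics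

/-- Second order Taylor expansion with little-o remainder. -/
lemma ContDiffAt.isLittleO_second_order {E : Type*} [NormedAddCommGroup E] [NormedSpace ℝ E]
    {f : E → ℝ} {x : E} (hf : ContDiffAt ℝ 2 f x) :
    (fun h => f (x + h) - f x - fderiv ℝ f x h - (1 / 2) * fderiv ℝ (fderiv ℝ f) x h h)
      =o[𝓝 0] (fun h => ‖h‖ ^ 2) := by
  set B := fderiv ℝ (fderiv ℝ f) x with hB
  have hsymm : ∀ v w, B v w = B w v := fun v w =>
    (hf.isSymmSndFDerivAt (by simp)).eq v w
  have hf' : DifferentiableAt ℝ (fderiv ℝ f) x :=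
    (hf.fderiv_right (m := 1) (by norm_num)).differentiableAt (by norm_num)
  have hd : ∀ᶠ y in 𝓝 x, DifferentiableAt ℝ f y :=
    (hf.eventually (by simp)).mono fun y hy => hy.differentiableAt (by norm_num)
  have htend : Tendsto (fun h : E => x + h) (𝓝 0) (𝓝 x) := by
    simpa using (continuous_const_add x).tendsto (0 : E)
  rw [isLittleO_iff]
  intro c hc
  have h1 := (hasFDerivAt_iff_isLittleO_nhds_zero.1 hf'.hasFDerivAt).def hc
  obtain ⟨δ, hδ, hball⟩ := Metric.eventually_nhds_iff_ball.1 (h1.and (htend.eventually hd))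
  filter_upwards [Metric.ball_mem_nhds (0 : E) hδ] with h hh
  have hder : ∀ k ∈ closedBall (0 : E) ‖h‖, HasFDerivWithinAt
      (fun h => f (x + h) - f x - fderiv ℝ f x h - (1 / 2) * B h h)
      (fderiv ℝ f (x + k) - fderiv ℝ f x - B k) (closedBall 0 ‖h‖) k := by
    intro k hk
    have hk' : k ∈ ball (0 : E) δ := by
      simp only [mem_closedBall, mem_ball, dist_zero_right] at hk hh ⊢
      exact hk.trans_lt hh
    have e1 : HasFDerivAt (fun h => f (x + h)) (fderiv ℝ f (x + k)) k := by
      have := (hball k hk').2.hasFDerivAt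
      simpa using (hasFDerivAt_comp_add_left (x := k) x).2 this
    have e2 : HasFDerivAt (fun h => B h h) _ k := B.hasFDerivAt.clm_apply (hasFDerivAt_id k)
    refine ((((e1.sub_const (f x)).sub (fderiv ℝ f x).hasFDerivAt).sub
      (e2.const_mul (1 / 2))).congr_fderiv ?_).hasFDerivWithinAt
    ext v
    simp [hsymm v k]
    ring
  have hbound : ∀ k ∈ closedBall (0 : E) ‖h‖,
      ‖fderiv ℝ f (x + k) - fderiv ℝ f x - B k‖ ≤ c * ‖h‖ := by
    intro k hk
    simp only [mem_closedBall, mem_ball, dist_zero_right] at hk hh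
    refine (hball k (by simpa using hk.trans_lt hh)).1.trans ?_
    gcongr
  have := (convex_closedBall (0 : E) ‖h‖).norm_image_sub_le_of_norm_hasFDerivWithin_le hder hbound
    (mem_closedBall_self (norm_nonneg h)) (by simp : h ∈ closedBall (0 : E) ‖h‖)
  simpa [pow_two, mul_assoc] using this

lemma setIntegral_ball_comp_isometry {E : Type*} [NormedAddCommGroup E] [InnerProductSpace ℝ E]
    [FiniteDimensional ℝ E] [MeasurableSpace E] [BorelSpace E] (e : E ≃ₗᵢ[ℝ] E) (F : E → ℝ)
    (r : ℝ) : ∫ h in ball (0 : E) r, F (e h) = ∫ h in ball (0 : E) r, F h := by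
  have := e.measurePreserving.setIntegral_preimage_emb
    e.toHomeomorph.measurableEmbedding F (ball 0 r)
  rwa [e.preimage_ball, map_zero] at this

lemma setIntegral_ball_linear {E : Type*} [NormedAddCommGroup E] [InnerProductSpace ℝ E]
    [FiniteDimensional ℝ E] [MeasurableSpace E] [BorelSpace E] (L : E →L[ℝ] ℝ) (r : ℝ) :
    ∫ h in ball (0 : E) r, L h = 0 := by
  have := setIntegral_ball_comp_isometry (LinearIsometryEquiv.neg ℝ) (fun h : E => L h) r
  simp only [LinearIsometryEquiv.coe_neg, map_neg, integral_neg] at this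
  linarith

lemma Continuous.integrableOn_euclidean_ball {d : ℕ} {F : EuclideanSpace ℝ (Fin d) → ℝ}
    (hF : Continuous F) (x : EuclideanSpace ℝ (Fin d)) (r : ℝ) : IntegrableOn F (ball x r) :=
  (hF.continuousOn.integrableOn_compact (isCompact_closedBall x r)).mono_set ball_subset_closedBall

/-- A trace-free quadratic form has zero integral over balls centred at the origin. -/
lemma setIntegral_ball_traceless {d : ℕ}
    (B : EuclideanSpace ℝ (Fin d) →L[ℝ] EuclideanSpace ℝ (Fin d) →L[ℝ] ℝ)
    (hB : ∑ i, B (EuclideanSpace.single i 1) (EuclideanSpace.single i 1) = 0) (r : ℝ) :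
    ∫ h in ball (0 : EuclideanSpace ℝ (Fin d)) r, B h h = 0 := by
  have hexp : ∀ h : EuclideanSpace ℝ (Fin d), B h h = ∑ i, ∑ j,
      (h i * h j) * B (EuclideanSpace.single i 1) (EuclideanSpace.single j 1) := by
    intro h
    have hh : h = ∑ i, h i • EuclideanSpace.single i (1 : ℝ) := by
      simpa using ((EuclideanSpace.basisFun (Fin d) ℝ).sum_repr h).symm
    conv_lhs => rw [hh]
    simp only [map_sum, map_smul, _root_.sum_apply, _root_.smul_apply,
      smul_eq_mul, Finset.mul_sum]
    rw [Finset.sum_comm]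
    refine Finset.sum_congr rfl fun i _ => Finset.sum_congr rfl fun j _ => by ring
  have hoff : ∀ i j : Fin d, i ≠ j →
      ∫ h in ball (0 : EuclideanSpace ℝ (Fin d)) r, h i * h j = 0 := by
    intro i j hij
    have := setIntegral_ball_comp_isometry
      (LinearIsometryEquiv.piLpCongrRight 2 (fun k : Fin d =>
        if k = i then LinearIsometryEquiv.neg ℝ else LinearIsometryEquiv.refl ℝ ℝ))
      (fun h : EuclideanSpace ℝ (Fin d) => h i * h j) r
    simp [hij.symm, integral_neg] at this
    linarith
  have hdiag : ∀ i j : Fin d, ∫ h in ball (0 : EuclideanSpace ℝ (Fin d)) r, h i * h i =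
      ∫ h in ball (0 : EuclideanSpace ℝ (Fin d)) r, h j * h j := by
    intro i j
    have := setIntegral_ball_comp_isometry
      (LinearIsometryEquiv.piLpCongrLeft 2 ℝ ℝ (Equiv.swap i j))
      (fun h : EuclideanSpace ℝ (Fin d) => h j * h j) r
    simpa [LinearIsometryEquiv.piLpCongrLeft_apply, Equiv.piCongrLeft'] using this
  have hint : ∀ i j : Fin d, IntegrableOn (fun h : EuclideanSpace ℝ (Fin d) =>
      (h i * h j) * B (EuclideanSpace.single i 1) (EuclideanSpace.single j 1)) (ball 0 r) :=
    fun i j => Continuous.integrableOn_euclidean_ball (by fun_prop) 0 r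
  simp_rw [hexp]
  rw [integral_finsetSum _ fun i _ => integrable_finsetSum _ fun j _ => hint i j]
  simp_rw [integral_finsetSum _ fun j _ => hint _ j, integral_mul_const]
  rcases isEmpty_or_nonempty (Fin d) with _ | ⟨⟨i₀⟩⟩
  · simp
  have : ∀ i : Fin d, (∑ j, (∫ h in ball (0 : EuclideanSpace ℝ (Fin d)) r, h i * h j) *
      B (EuclideanSpace.single i 1) (EuclideanSpace.single j 1)) =
      (∫ h in ball (0 : EuclideanSpace ℝ (Fin d)) r, h i₀ * h i₀) *
      B (EuclideanSpace.single i 1) (EuclideanSpace.single i 1) := by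
    intro i
    rw [Finset.sum_eq_single i (fun j _ hj => by rw [hoff i j hj.symm, zero_mul]) (by simp),
      hdiag i i₀]
  simp_rw [this, ← Finset.mul_sum, hB, mul_zero]

/-- A function with the super-mean-value property cannot be touched from below by a quadratic
polynomial with positive Laplacian. -/
lemma SuperMeanVal.not_touch {n : ℕ} {w : EuclideanSpace ℝ (Fin (n + 1)) → ℝ}
    (hw : Continuous w) (hmean : SuperMeanVal (n + 1) w) (x : EuclideanSpace ℝ (Fin (n + 1)))
    (L : EuclideanSpace ℝ (Fin (n + 1)) →L[ℝ] ℝ)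
    (B : EuclideanSpace ℝ (Fin (n + 1)) →L[ℝ] EuclideanSpace ℝ (Fin (n + 1)) →L[ℝ] ℝ)
    (hB : ∑ i, B (EuclideanSpace.single i 1) (EuclideanSpace.single i 1) = 0)
    {c : ℝ} (hc : 0 < c) : ¬ ∀ᶠ h in 𝓝 0, w x + L h + B h h + c * ‖h‖ ^ 2 ≤ w (x + h) := by
  intro hev
  obtain ⟨r, hr, hball⟩ := Metric.eventually_nhds_iff_ball.1 hev
  set b := ball (0 : EuclideanSpace ℝ (Fin (n + 1))) r with hb
  have hvol : 0 < volume.real b :=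
    ENNReal.toReal_pos (measure_ball_pos _ _ hr).ne' measure_ball_lt_top.ne
  have hshift : ∫ y in ball x r, w y = ∫ h in b, w (x + h) := by
    have := (measurePreserving_add_left volume x).setIntegral_preimage_emb
      (Homeomorph.addLeft x).measurableEmbedding w (ball x r)
    rw [← this]
    simp [hb]
  have hvol' : volume.real (ball x r) = volume.real b := by
    simp only [Measure.real, hb, Measure.addHaar_ball_center]
  have hle := hmean x r hr
  rw [setAverage_eq, hshift, hvol', smul_eq_mul, inv_mul_le_iff₀ hvol] at hle
  have hconst : IntegrableOn (fun _ => w x) b := integrableOn_const measure_ball_lt_top.ne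
  have hL : IntegrableOn (fun h => L h) b :=
    Continuous.integrableOn_euclidean_ball (by fun_prop) 0 r
  have hBi : IntegrableOn (fun h => B h h) b :=
    Continuous.integrableOn_euclidean_ball (by fun_prop) 0 r
  have hsq : IntegrableOn (fun h => c * ‖h‖ ^ 2) b :=
    Continuous.integrableOn_euclidean_ball (by fun_prop) 0 r
  have hmono : ∫ h in b, (w x + L h + B h h + c * ‖h‖ ^ 2) ≤ ∫ h in b, w (x + h) :=
    setIntegral_mono_on (((hconst.add hL).add hBi).add hsq)
      (Continuous.integrableOn_euclidean_ball (by fun_prop) 0 r) measurableSet_ball hball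
  have hpos : 0 < ∫ h in b, c * ‖h‖ ^ 2 := by
    rw [setIntegral_pos_iff_support_of_nonneg_ae (ae_of_all _ fun h => by positivity) hsq]
    have : (Function.support fun h : EuclideanSpace ℝ (Fin (n + 1)) => c * ‖h‖ ^ 2) ∩ b
        = b \ {0} := by
      ext h
      simp [hc.ne', and_comm]
    rw [this, measure_sdiff_null (measure_singleton _)]
    exact measure_ball_pos _ _ hr
  have hsplit : ∫ h in b, (w x + L h + B h h + c * ‖h‖ ^ 2) =
      (∫ _ in b, w x) + (∫ h in b, L h) + (∫ h in b, B h h) + ∫ h in b, c * ‖h‖ ^ 2 := by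
    rw [← integral_add' hconst hL, ← integral_add' (hconst.add hL) hBi,
      ← integral_add' ((hconst.add hL).add hBi) hsq]
    rfl
  rw [hsplit, setIntegral_ball_linear, setIntegral_ball_traceless B hB,
    setIntegral_const, smul_eq_mul] at hmono
  linarith

lemma lapl_eq_trace {d : ℕ} {f : EuclideanSpace ℝ (Fin d) → ℝ} {x : EuclideanSpace ℝ (Fin d)}
    (hf : ContDiffAt ℝ 2 f x) :
    lapl d f x = ∑ i, fderiv ℝ (fderiv ℝ f) x (EuclideanSpace.single i 1)
      (EuclideanSpace.single i 1) := by
  have hf' : DifferentiableAt ℝ (fderiv ℝ f) x :=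
    (hf.fderiv_right (m := 1) (by norm_num)).differentiableAt (by norm_num)
  refine Finset.sum_congr rfl fun i _ => ?_
  rw [fderiv_clm_apply hf' (differentiableAt_const _)]
  simp

lemma pev_smul_of_isHomogeneous {d m : ℕ} {q : MvPolynomial (Fin d) ℝ} (hq : q.IsHomogeneous m)
    (s : ℝ) (x : EuclideanSpace ℝ (Fin d)) : pev q (s • x) = s ^ m * pev q x := by
  simp only [pev, MvPolynomial.eval_eq', Finset.mul_sum]
  refine Finset.sum_congr rfl fun e he => ?_
  have hdeg : ∑ i, e i = m := by
    have := hq (MvPolynomial.mem_support_iff.1 he)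
    simpa [Finsupp.weight_apply, Finsupp.sum_fintype] using this
  rw [← hdeg, ← Finset.prod_pow_eq_pow_sum]
  simp only [PiLp.smul_apply, smul_eq_mul, mul_pow, Finset.prod_mul_distrib]
  ring

lemma thinEmbed_thinProj {n : ℕ} {x : EuclideanSpace ℝ (Fin (n + 1))} (hx : x (Fin.last n) = 0) :
    thinEmbed n (thinProj n x) 0 = x := by
  ext i
  refine Fin.lastCases ?_ (fun j => ?_) i <;> simp [thinEmbed, thinProj, hx]

lemma nonneg_of_last_eq_zero {n : ℕ} {u : EuclideanSpace ℝ (Fin (n + 1)) → ℝ}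
    (hu : IsGlobalSolution n (fun _ => 0) u) {x : EuclideanSpace ℝ (Fin (n + 1))}
    (hx : x (Fin.last n) = 0) : 0 ≤ u x := by
  simpa [thinEmbed_thinProj hx] using hu.2.2.1 (thinProj n x)

lemma isClosed_contactSet_zero {n : ℕ} {u : EuclideanSpace ℝ (Fin (n + 1)) → ℝ}
    (hu : Continuous u) : IsClosed (contactSet n (fun _ => 0) u) :=
  (isClosed_eq (by fun_prop) continuous_const).inter (isClosed_eq hu continuous_const)

lemma norm_thinProj {n : ℕ} {x : EuclideanSpace ℝ (Fin (n + 1))} (hx : x (Fin.last n) = 0) :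
    ‖thinProj n x‖ = ‖x‖ := by
  simp [EuclideanSpace.norm_eq, Fin.sum_univ_castSucc, hx, thinProj]

/-- Comparison of `u` with its rescalings `s⁻ᵐ u(s ·)`, `0 < s < 1`. -/
lemma IsGlobalSolution.rescale_le {n m : ℕ} {ph : MvPolynomial (Fin (n + 1)) ℝ} (hm : m ≠ 0)
    (hph : ph.IsHomogeneous m) {u : EuclideanSpace ℝ (Fin (n + 1)) → ℝ}
    (hu : IsGlobalSolution n (fun _ => 0) u)
    (hdecay : VanishAtInfty (n + 1) (fun x => u x - pev (ph - 1) x))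
    {s : ℝ} (hs0 : 0 < s) (hs1 : s < 1) (x : EuclideanSpace ℝ (Fin (n + 1))) :
    (s ^ m)⁻¹ * u (s • x) ≤ u x := by
  by_contra! hx
  have hpev : ∀ y, pev (ph - 1) y = pev ph y - 1 := fun y => by simp [pev]
  have hcont : Continuous u := hu.1
  set a := (s ^ m)⁻¹ with ha
  have ha1 : 1 < a := (one_lt_inv₀ (by positivity)).2 (pow_lt_one₀ hs0.le hs1 hm)
  have ham : a * s ^ m = 1 := inv_mul_cancel₀ (by positivity)
  obtain ⟨R₀, hR₀⟩ := hdecay ((a - 1) / (1 + a)) (by apply div_pos <;> linarith)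
  set R := max R₀ 0 / s with hR
  have hRs : R * s = max R₀ 0 := div_mul_cancel₀ _ hs0.ne'
  have hRnn : 0 ≤ R := by positivity
  have hinf : ∀ y, R ≤ ‖y‖ → 0 ≤ u y - a * u (s • y) := by
    intro y hy
    have h1 : R₀ ≤ ‖s • y‖ := by
      rw [norm_smul, Real.norm_of_nonneg hs0.le]
      have := le_max_left R₀ 0
      nlinarith
    have h2 : R₀ ≤ ‖y‖ := by
      rw [norm_smul, Real.norm_of_nonneg hs0.le] at h1
      nlinarith [norm_nonneg y]
    have k1 := abs_lt.1 (hR₀ _ h1)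
    have k2 := abs_lt.1 (hR₀ _ h2)
    simp only [hpev, pev_smul_of_isHomogeneous hph] at k1 k2
    set δ := (a - 1) / (1 + a) with hδ
    have hδa : δ * (1 + a) = a - 1 := div_mul_cancel₀ _ (by linarith)
    have k3 := mul_lt_mul_of_pos_left k1.2 (by linarith : 0 < a)
    have k4 : a * (u (s • y) - (s ^ m * pev ph y - 1)) = a * u (s • y) - pev ph y + a := by
      linear_combination (-pev ph y) * ham
    linarith [k2.1]
  set μ := a * u (s • x) - u x with hμ
  have hμ0 : 0 < μ := by linarith
  set ρ := max R ‖x‖ + 1 with hρ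
  have hρ0 : 0 < ρ := by positivity
  have hRρ : R < ρ := by linarith [le_max_left R ‖x‖]
  have hxρ : ‖x‖ < ρ := by linarith [le_max_right R ‖x‖]
  set ε := μ / (2 * ρ ^ 2) with hε
  have hε0 : 0 < ε := by positivity
  have hερ : ε * ρ ^ 2 = μ / 2 := by rw [hε]; field_simp
  obtain ⟨x₀, hx₀, hmin⟩ := (isCompact_closedBall (0 : EuclideanSpace ℝ (Fin (n + 1))) ρ)
    |>.exists_isMinOn ⟨x, by simpa using hxρ.le⟩
    (f := fun y => u y - a * u (s • y) - ε * ‖y‖ ^ 2) (by fun_prop)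
  have hx₀' : ‖x₀‖ ≤ ρ := by simpa using hx₀
  have hle : u x₀ - a * u (s • x₀) - ε * ‖x₀‖ ^ 2 ≤ -μ := by
    have : u x₀ - a * u (s • x₀) - ε * ‖x₀‖ ^ 2 ≤ u x - a * u (s • x) - ε * ‖x‖ ^ 2 :=
      hmin (by simpa using hxρ.le)
    have : 0 ≤ ε * ‖x‖ ^ 2 := by positivity
    linarith
  have hsq : ε * ‖x₀‖ ^ 2 ≤ μ / 2 := hερ ▸ by gcongr
  have hneg : u x₀ - a * u (s • x₀) < 0 := by linarith
  have hint : ‖x₀‖ < ρ := by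
    by_contra! h
    linarith [hinf x₀ (by linarith)]
  have hnot : s • x₀ ∉ contactSet n (fun _ => 0) u := by
    rintro ⟨h1, h2⟩
    have h3 : x₀ (Fin.last n) = 0 := by simpa [hs0.ne'] using h1
    have := nonneg_of_last_eq_zero hu h3
    simp only at h2
    rw [h2] at hneg
    linarith
  have hnhds := (isClosed_contactSet_zero hcont).isOpen_compl.mem_nhds hnot
  have hC2 : ContDiffAt ℝ 2 u (s • x₀) := hu.2.2.2.1.1.contDiffAt hnhds
  have htr := hu.2.2.2.1.2 _ hnot
  rw [lapl_eq_trace hC2] at htr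
  set L := fderiv ℝ u (s • x₀) with hL
  set B := fderiv ℝ (fderiv ℝ u) (s • x₀) with hB
  refine SuperMeanVal.not_touch hcont hu.2.2.2.2 x₀ ((a * s) • L + (2 * ε) • innerSL ℝ x₀)
    ((a * s ^ 2 / 2) • B) (by simp [← Finset.mul_sum, htr]) (half_pos hε0) ?_
  have htaylor := hC2.isLittleO_second_order.def
    (show 0 < ε / (2 * a * s ^ 2) by positivity)
  have hscale : Tendsto (fun h : EuclideanSpace ℝ (Fin (n + 1)) => s • h) (𝓝 0) (𝓝 0) := by
    simpa using (continuous_const_smul s).tendsto (0 : EuclideanSpace ℝ (Fin (n + 1)))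
  have hshift : Tendsto (fun h : EuclideanSpace ℝ (Fin (n + 1)) => x₀ + h) (𝓝 0) (𝓝 x₀) := by
    simpa using (continuous_const_add x₀).tendsto (0 : EuclideanSpace ℝ (Fin (n + 1)))
  have hmem : closedBall (0 : EuclideanSpace ℝ (Fin (n + 1))) ρ ∈ 𝓝 x₀ :=
    closedBall_mem_nhds_of_mem (by simpa using hint)
  filter_upwards [hscale.eventually htaylor, hshift.eventually hmem] with h hT hmem
  have hm' : u x₀ - a * u (s • x₀) - ε * ‖x₀‖ ^ 2 ≤
    u (x₀ + h) - a * u (s • (x₀ + h)) - ε * ‖x₀ + h‖ ^ 2 := hmin hmem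
  rw [norm_add_sq_real, smul_add] at hm'
  simp only [map_smul, _root_.smul_apply, smul_eq_mul, norm_smul, norm_pow, norm_norm, norm_mul,
    Real.norm_of_nonneg hs0.le] at hT
  have hT' := mul_le_mul_of_nonneg_left (neg_le_of_abs_le hT) (by positivity : 0 ≤ a)
  have hcoef : a * (ε / (2 * a * s ^ 2) * (s * ‖h‖) ^ 2) = ε / 2 * ‖h‖ ^ 2 := by
    field_simp
  simp only [_root_.add_apply, _root_.smul_apply, smul_eq_mul, innerSL_apply_apply]
  linarith

/-- if `p = p^h - 1 ∈ 𝒫ᵉ_{n+1}` with `p^h` homogeneous of degree `m ≥ 2`,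
the corresponding global solution has compact, star-shaped contact set. -/
theorem statement8 (n m : ℕ) (hn : 2 ≤ n) (hm : 2 ≤ m)
    (ph p : MvPolynomial (Fin (n + 1)) ℝ)
    (hph : ph.IsHomogeneous m) (hp : p = ph - 1) (hpPe : MemPe n p)
    (u : EuclideanSpace ℝ (Fin (n + 1)) → ℝ)
    (hu : IsGlobalSolution n (fun _ => 0) u)
    (hdecay : VanishAtInfty (n + 1) (fun x => u x - pev p x)) :
    IsCompact (contactSet n (fun _ => 0) u) ∧
    ∀ x ∈ contactSet n (fun _ => 0) u, ∀ t ∈ Set.Icc (0 : ℝ) 1,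
      t • x ∈ contactSet n (fun _ => 0) u := by
  subst hp
  have hclosed := isClosed_contactSet_zero hu.1
  have hpev : ∀ y, pev (ph - 1) y = pev ph y - 1 := fun y => by simp [pev]
  refine ⟨Metric.isCompact_of_isClosed_isBounded hclosed ?_, fun x hx t ht => ?_⟩
  · obtain ⟨C, hC⟩ := hpPe.2.2.isBounded.exists_norm_le
    obtain ⟨R, hR⟩ := hdecay (1 / 2) (by norm_num)
    refine isBounded_iff_forall_norm_le.2 ⟨max R (2 * C), fun x hx => ?_⟩
    rcases le_total ‖x‖ R with h | h
    · exact h.trans (le_max_left _ _)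
    refine le_trans ?_ (le_max_right _ _)
    obtain ⟨hx0, hux⟩ := hx
    have hlt := (abs_lt.1 (hR x h)).1
    simp only [hpev] at hlt hux
    have hy0 : ((1 / 2 : ℝ) • x) (Fin.last n) = 0 := by simp [hx0]
    have hpow : (1 / 2 : ℝ) ^ m ≤ (1 / 2) ^ 2 :=
      pow_le_pow_of_le_one (by norm_num) (by norm_num) hm
    have hpow0 : (0 : ℝ) < (1 / 2) ^ m := by positivity
    have hneg : pev (ph - 1) (thinEmbed n (thinProj n ((1 / 2 : ℝ) • x)) 0) < 0 := by
      rw [thinEmbed_thinProj hy0, hpev, pev_smul_of_isHomogeneous hph]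
      nlinarith
    have := hC _ (subset_closure hneg)
    rw [norm_thinProj hy0, norm_smul, Real.norm_of_nonneg (by norm_num)] at this
    linarith
  · have hIoo : ∀ s ∈ Ioo (0 : ℝ) 1, s • x ∈ contactSet n (fun _ => 0) u := by
      intro s hs
      have hlast : (s • x) (Fin.last n) = 0 := by simp [hx.1]
      refine ⟨hlast, le_antisymm ?_ (nonneg_of_last_eq_zero hu hlast)⟩
      have h := hu.rescale_le (by omega) hph hdecay hs.1 hs.2 x
      rw [hx.2] at h
      exact nonpos_of_mul_nonpos_right h (inv_pos.2 (pow_pos hs.1 m))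
    have hsub := closure_minimal (s := Ioo (0 : ℝ) 1) hIoo
      (hclosed.preimage (continuous_id.smul continuous_const))
    rw [closure_Ioo zero_ne_one] at hsub
    exact hsub ht

end
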